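/- arXiv:2503.09301 — 4 statements merged into one kernel-verified Lean document; each statement's English description precedes it below -/
import Mathlib

section
/- Let (C,d) be a bounded chain complex of finite-dimensional k-vector spaces with a fixed totally ordered finite basis 𝔄_n of each C_n. Then for each n there exists a separating basis (ℌ_n, 𝔅_n, 𝔓_n) for C_n with respect to 𝔄_n. -/
open LinearMap Submodule

/-! ## Gradings of vector spaces -/

/-- An internal grading of a vector space `V` by an index type `ι`, given by a
system of orthogonal idempotent projections which sum (pointwise, with finite
support) to the identity.  The graded piece at `i` is the range of `proj i`. -/
structure VGrading (k V ι : Type*) [Field k] [AddCommGroup V] [Module k V] where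
  proj : ι → V →ₗ[k] V
  proj_idem : ∀ i, proj i ∘ₗ proj i = proj i
  proj_orth : ∀ i j, i ≠ j → proj i ∘ₗ proj j = 0
  proj_finite : ∀ v : V, (Function.support fun i => proj i v).Finite
  proj_total : ∀ v : V, (∑ᶠ i, proj i v) = v

namespace VGrading

variable {k V ι : Type*} [Field k] [AddCommGroup V] [Module k V]

/-- The graded piece of a grading at index `i`. -/
def piece (G : VGrading k V ι) (i : ι) : Submodule k V := LinearMap.range (G.proj i)

end VGrading

/-- The `(i,j)` component of a linear map between `ι`-graded vector spaces:
include the `j`-th piece, apply `f`, project to the `i`-th piece. -/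
def gcomp {k V W ι : Type*} [Field k] [AddCommGroup V] [Module k V]
    [AddCommGroup W] [Module k W]
    (GW : VGrading k W ι) (GV : VGrading k V ι) (f : V →ₗ[k] W) (i j : ι) :
    V →ₗ[k] W :=
  GW.proj i ∘ₗ (f ∘ₗ GV.proj j)

/-! ## Contractions and perturbations -/

/-- A contraction `(f, g, h)` from the differential `dC` on `V` onto the
differential `dD` on `W`: `f, g` are chain maps, `f ∘ g = 1`,
`g ∘ f = 1 + dC h + h dC`, and the side conditions `f h = 0`, `h g = 0`,
`h h = 0` hold. -/
structure IsContraction {k V W : Type*} [Field k] [AddCommGroup V] [Module k V]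
    [AddCommGroup W] [Module k W]
    (dC : V →ₗ[k] V) (dD : W →ₗ[k] W)
    (f : V →ₗ[k] W) (g : W →ₗ[k] V) (h : V →ₗ[k] V) : Prop where
  f_chain : f ∘ₗ dC = dD ∘ₗ f
  g_chain : g ∘ₗ dD = dC ∘ₗ g
  fg : f ∘ₗ g = LinearMap.id
  gf : g ∘ₗ f = LinearMap.id + dC ∘ₗ h + h ∘ₗ dC
  fh : f ∘ₗ h = 0
  hg : h ∘ₗ g = 0
  hh : h ∘ₗ h = 0

/-- Iterated composition of an endomorphism. -/
def endPow {k V : Type*} [Field k] [AddCommGroup V] [Module k V]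
    (f : V →ₗ[k] V) : ℕ → (V →ₗ[k] V)
  | 0 => LinearMap.id
  | n + 1 => f ∘ₗ endPow f n

/-- `S` is the sum `Σ_{n ≥ 0} δ (h δ)^n`, which is well defined whenever
`h δ` is locally nilpotent: on every vector the series is eventually zero and
`S` is given by the corresponding finite partial sum. -/
def IsPerturbSum {k V : Type*} [Field k] [AddCommGroup V] [Module k V]
    (δ h S : V →ₗ[k] V) : Prop :=
  ∀ v : V, ∃ N : ℕ, (∀ m : ℕ, N ≤ m → endPow (h ∘ₗ δ) m v = 0) ∧
    S v = ∑ i ∈ Finset.range N, (δ ∘ₗ endPow (h ∘ₗ δ) i) v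

/-! ## Chain complexes over a field (graded by `ℤ`) -/

/-- A chain complex of `k`-vector spaces, realised internally to a single
carrier `V`: a `ℤ`-grading together with a square-zero differential of
degree `-1`. -/
structure ZCC (k V : Type*) [Field k] [AddCommGroup V] [Module k V] where
  gr : VGrading k V ℤ
  d : V →ₗ[k] V
  d_sq : d ∘ₗ d = 0
  d_deg : ∀ n : ℤ, ∀ v ∈ gr.piece n, d v ∈ gr.piece (n - 1)

namespace ZCC

variable {k V : Type*} [Field k] [AddCommGroup V] [Module k V]

/-- `n`-cycles. -/
def cycles (C : ZCC k V) (n : ℤ) : Submodule k V := C.gr.piece n ⊓ LinearMap.ker C.d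

/-- `n`-boundaries. -/
def bdries (C : ZCC k V) (n : ℤ) : Submodule k V := (C.gr.piece (n + 1)).map C.d

/-- The `n`-th homology `ker d_n / im d_{n+1}`. -/
abbrev homology (C : ZCC k V) (n : ℤ) :=
  ↥(C.cycles n) ⧸ Submodule.comap (C.cycles n).subtype (C.bdries n)

/-- A chain complex is bounded if only finitely many chain groups are nonzero. -/
def Bounded (C : ZCC k V) : Prop := {n : ℤ | C.gr.proj n ≠ 0}.Finite

end ZCC

/-- A map between `ℤ`-graded spaces has degree `r`. -/
def HasDeg {k V W : Type*} [Field k] [AddCommGroup V] [Module k V]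
    [AddCommGroup W] [Module k W]
    (GV : VGrading k V ℤ) (GW : VGrading k W ℤ) (f : V →ₗ[k] W) (r : ℤ) : Prop :=
  ∀ n : ℤ, ∀ v ∈ GV.piece n, f v ∈ GW.piece (n + r)

/-! ## Based complexes and algebraic Morse theory -/

/-- A based complex: a chain complex whose chain groups are further decomposed
as direct sums indexed by `ι`; `deg : ι → ℤ` records which chain group each
basis index belongs to.  Components of the differential can only drop the
degree by one. -/
structure BasedComplex (k V ι : Type*) [Field k] [AddCommGroup V] [Module k V] where
  gr : VGrading k V ι
  deg : ι → ℤ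
  d : V →ₗ[k] V
  d_sq : d ∘ₗ d = 0
  d_comp_deg : ∀ α β : ι, deg β ≠ deg α - 1 → gr.proj β ∘ₗ (d ∘ₗ gr.proj α) = 0

namespace BasedComplex

variable {k V ι : Type*} [Field k] [AddCommGroup V] [Module k V]

/-- The component `d^{βα} : K^α → K^β` of the differential (as an endomorphism
of the carrier). -/
def dcomp (K : BasedComplex k V ι) (β α : ι) : V →ₗ[k] V :=
  K.gr.proj β ∘ₗ (K.d ∘ₗ K.gr.proj α)

/-- The digraph `G_K`: there is an edge `α → β` whenever `d^{βα} ≠ 0`. -/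
def Edge (K : BasedComplex k V ι) (α β : ι) : Prop := K.dcomp β α ≠ 0

/-- The component `d^{βα}` restricts to an isomorphism `K^α → K^β`. -/
def CompIso (K : BasedComplex k V ι) (α β : ι) : Prop :=
  (∀ v ∈ K.gr.piece α, K.dcomp β α v = 0 → v = 0) ∧
  (K.gr.piece α).map (K.dcomp β α) = K.gr.piece β

/-- The edge relation of the digraph `G^μ_K` obtained from `G_K` by reversing
exactly the edges in `μ`. -/
def MuEdge (K : BasedComplex k V ι) (μ : Set (ι × ι)) (α β : ι) : Prop :=
  (K.Edge α β ∧ (α, β) ∉ μ) ∨ (β, α) ∈ μ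

/-- A partial matching on `G_K`: a set of edges, no two of which share a
vertex. -/
def IsPartialMatching (K : BasedComplex k V ι) (μ : Set (ι × ι)) : Prop :=
  (∀ e ∈ μ, K.Edge e.1 e.2) ∧
  ∀ e ∈ μ, ∀ e' ∈ μ, e ≠ e' → e.1 ≠ e'.1 ∧ e.1 ≠ e'.2 ∧ e.2 ≠ e'.1 ∧ e.2 ≠ e'.2

/-- A Morse matching: a partial matching all of whose matched components are
isomorphisms, together with a well-founded (strict) partial order on each
`I_n` such that any path `α → γ → β` in `G^μ_K` between indices of the same
degree satisfies `β ≺ α`. -/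
def IsMorseMatching (K : BasedComplex k V ι) (μ : Set (ι × ι)) : Prop :=
  K.IsPartialMatching μ ∧ (∀ e ∈ μ, K.CompIso e.1 e.2) ∧
  ∃ r : ι → ι → Prop, (∀ a b, r a b → K.deg a = K.deg b) ∧ Transitive r ∧
    WellFounded r ∧
    ∀ α γ β : ι, K.deg β = K.deg α → K.MuEdge μ α γ → K.MuEdge μ γ β → r β α

/-- A vertex is critical for the matching `μ` if it is incident to no edge
of `μ`. -/
def IsCritical (μ : Set (ι × ι)) (α : ι) : Prop := ∀ e ∈ μ, e.1 ≠ α ∧ e.2 ≠ α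

/-- The map `d̃`: the sum of the matched components of the differential. -/
noncomputable def dtilde (K : BasedComplex k V ι) (μ : Set (ι × ι)) : V →ₗ[k] V :=
  ∑ᶠ (e : ι × ι) (_ : e ∈ μ), K.dcomp e.2 e.1

/-- The projection onto the span of the critical pieces. -/
noncomputable def critProj (K : BasedComplex k V ι) (μ : Set (ι × ι)) : V →ₗ[k] V :=
  ∑ᶠ (α : ι) (_ : IsCritical μ α), K.gr.proj α

/-- The span of the critical pieces, i.e. the chain groups of the Morse
complex `K^{(μ)}`. -/
def critSub (K : BasedComplex k V ι) (μ : Set (ι × ι)) : Submodule k V :=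
  ⨆ (α : ι) (_ : IsCritical μ α), K.gr.piece α

/-- `ht` is the map `h̃` associated to the matching: it vanishes on every
piece which is not the target of a matched edge, and on the piece `K^β` with
`(α → β) ∈ μ` it is minus the inverse of `d^{βα}`. -/
def IsHTildeB (K : BasedComplex k V ι) (μ : Set (ι × ι)) (ht : V →ₗ[k] V) : Prop :=
  (∀ c : ι, (¬ ∃ a : ι, (a, c) ∈ μ) → ht ∘ₗ K.gr.proj c = 0) ∧
  ∀ a b : ι, (a, b) ∈ μ → ∀ v ∈ K.gr.piece b,
    ht v ∈ K.gr.piece a ∧ K.dcomp b a (ht v) = -v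

end BasedComplex

/-! ## `P`-graded chain complexes -/

/-- A `P`-graded chain complex: the carrier is graded by `ℤ × P`
(chain degree and poset grade), the differential is square-zero, drops the
chain degree by one and is `P`-filtered: components from grade `q` to grade
`p` vanish unless `p ≤ q`. -/
structure PCC (k V P : Type*) [Field k] [AddCommGroup V] [Module k V]
    [PartialOrder P] where
  gr : VGrading k V (ℤ × P)
  d : V →ₗ[k] V
  d_sq : d ∘ₗ d = 0
  d_filt : ∀ (n m : ℤ) (p q : P),
    (m = n - 1 ∧ p ≤ q) ∨ gr.proj (m, p) ∘ₗ (d ∘ₗ gr.proj (n, q)) = 0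

namespace PCC

variable {k V P : Type*} [Field k] [AddCommGroup V] [Module k V] [PartialOrder P]

/-- The twisted differential `t^{pq}_n : C^q_n → C^p_{n-1}`
(as an endomorphism of the carrier). -/
def tcomp (C : PCC k V P) (n : ℤ) (p q : P) : V →ₗ[k] V :=
  C.gr.proj (n - 1, p) ∘ₗ (C.d ∘ₗ C.gr.proj (n, q))

/-- Only finitely many chain groups are nonzero. -/
def Bounded (C : PCC k V P) : Prop := {i : ℤ × P | C.gr.proj i ≠ 0}.Finite

/-- Cycles of the relative chain complex `(C^p, t^p)` in degree `n`. -/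
def relCycles (C : PCC k V P) (n : ℤ) (p : P) : Submodule k V :=
  LinearMap.range (C.gr.proj (n, p)) ⊓ LinearMap.ker (C.tcomp n p p)

/-- Boundaries of the relative chain complex `(C^p, t^p)` in degree `n`. -/
def relBdries (C : PCC k V P) (n : ℤ) (p : P) : Submodule k V :=
  LinearMap.range (C.tcomp (n + 1) p p)

/-- The relative homology `H_n(C^p, t^p)`. -/
abbrev relHomology (C : PCC k V P) (n : ℤ) (p : P) :=
  ↥(C.relCycles n p) ⧸ Submodule.comap (C.relCycles n p).subtype (C.relBdries n p)

/-- The diagonal part `d̃ = Σ_p t^p` of the differential. -/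
noncomputable def dtilde (C : PCC k V P) : V →ₗ[k] V :=
  ∑ᶠ i : ℤ × P, C.gr.proj (i.1 - 1, i.2) ∘ₗ (C.d ∘ₗ C.gr.proj i)

/-- The strictly off-diagonal part `δ = Σ_{p < q} t^{pq} = d - d̃` of the
differential. -/
noncomputable def delta (C : PCC k V P) : V →ₗ[k] V := C.d - C.dtilde

/-- The sublevel subcomplex `F^p = ⊕_{q ≤ p} C^q`. -/
def Fle (C : PCC k V P) (p : P) : Submodule k V :=
  ⨆ (i : ℤ × P) (_ : i.2 ≤ p), LinearMap.range (C.gr.proj i)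

/-- The strict sublevel subcomplex `F^p̌ = ⊕_{q < p} C^q`. -/
def Flt (C : PCC k V P) (p : P) : Submodule k V :=
  ⨆ (i : ℤ × P) (_ : i.2 < p), LinearMap.range (C.gr.proj i)

/-- The total relative chain group `C^p = ⊕_n C^p_n` at grade `p`. -/
def Cp (C : PCC k V P) (p : P) : Submodule k V :=
  ⨆ n : ℤ, LinearMap.range (C.gr.proj (n, p))

end PCC

/-- A linear map between `(ℤ × P)`-graded spaces is `P`-filtered: its
components from grade `q` to grade `p` vanish unless `p ≤ q`. -/
def PFilt {k V W P : Type*} [Field k] [AddCommGroup V] [Module k V]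
    [AddCommGroup W] [Module k W] [PartialOrder P]
    (GV : VGrading k V (ℤ × P)) (GW : VGrading k W (ℤ × P)) (f : V →ₗ[k] W) : Prop :=
  ∀ (n m : ℤ) (p q : P), ¬ p ≤ q → GW.proj (m, p) ∘ₗ (f ∘ₗ GV.proj (n, q)) = 0

/-- A linear map between `(ℤ × P)`-graded spaces has chain degree `r`. -/
def HasDegZP {k V W P : Type*} [Field k] [AddCommGroup V] [Module k V]
    [AddCommGroup W] [Module k W] [PartialOrder P]
    (GV : VGrading k V (ℤ × P)) (GW : VGrading k W (ℤ × P)) (f : V →ₗ[k] W)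
    (r : ℤ) : Prop :=
  ∀ (n m : ℤ) (p q : P), m ≠ n + r → GW.proj (m, q) ∘ₗ (f ∘ₗ GV.proj (n, p)) = 0

/-- A linear map between `P`-graded spaces is `P`-filtered. -/
def PFilt0 {k V W P : Type*} [Field k] [AddCommGroup V] [Module k V]
    [AddCommGroup W] [Module k W] [PartialOrder P]
    (GW : VGrading k W P) (GV : VGrading k V P) (f : V →ₗ[k] W) : Prop :=
  ∀ p q : P, ¬ p ≤ q → GW.proj p ∘ₗ (f ∘ₗ GV.proj q) = 0

/-! ## Consistent splittings -/

/-- A consistent splitting of a `P`-graded chain complex: each relative chain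
group `C^p_n` is split as an internal direct sum `M^p_n ⊕ B^p_n ⊕ K^p_n`
(recorded by three orthogonal idempotents summing to the grading projection),
where the `B`-summand is the space of relative boundaries `im(t^p_{n+1})`,
the `M`- and `B`-summands together span the relative cycles `ker(t^p_n)`,
and `t^p_n` maps the `K`-summand isomorphically onto `B^p_{n-1}`. -/
structure ConsSplit {k V P : Type*} [Field k] [AddCommGroup V] [Module k V]
    [PartialOrder P] (C : PCC k V P) where
  piM : ℤ → P → (V →ₗ[k] V)
  piB : ℤ → P → (V →ₗ[k] V)
  piK : ℤ → P → (V →ₗ[k] V)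
  sum_eq : ∀ n p, piM n p + piB n p + piK n p = C.gr.proj (n, p)
  idem_M : ∀ n p, piM n p ∘ₗ piM n p = piM n p
  idem_B : ∀ n p, piB n p ∘ₗ piB n p = piB n p
  idem_K : ∀ n p, piK n p ∘ₗ piK n p = piK n p
  orth_MB : ∀ n p, piM n p ∘ₗ piB n p = 0
  orth_BM : ∀ n p, piB n p ∘ₗ piM n p = 0
  orth_MK : ∀ n p, piM n p ∘ₗ piK n p = 0
  orth_KM : ∀ n p, piK n p ∘ₗ piM n p = 0
  orth_BK : ∀ n p, piB n p ∘ₗ piK n p = 0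
  orth_KB : ∀ n p, piK n p ∘ₗ piB n p = 0
  range_B : ∀ n p, LinearMap.range (piB n p) = LinearMap.range (C.tcomp (n + 1) p p)
  ker_split : ∀ n p, LinearMap.range (piM n p) ⊔ LinearMap.range (piB n p)
      = LinearMap.range (C.gr.proj (n, p)) ⊓ LinearMap.ker (C.tcomp n p p)
  K_inj : ∀ n p, ∀ v ∈ LinearMap.range (piK n p), C.tcomp n p p v = 0 → v = 0
  K_onto : ∀ n p, (LinearMap.range (piK n p)).map (C.tcomp n p p)
      = LinearMap.range (piB (n - 1) p)

namespace ConsSplit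

variable {k V P : Type*} [Field k] [AddCommGroup V] [Module k V] [PartialOrder P]
  {C : PCC k V P}

/-- The projection `j_M` onto the total Morse summand `M = ⊕_{n,p} M^p_n`. -/
noncomputable def projM (sp : ConsSplit C) : V →ₗ[k] V := ∑ᶠ i : ℤ × P, sp.piM i.1 i.2

/-- The projection `j_K` onto the total preboundary summand. -/
noncomputable def projK (sp : ConsSplit C) : V →ₗ[k] V := ∑ᶠ i : ℤ × P, sp.piK i.1 i.2

/-- The total Morse summand `M = ⊕_{n,p} M^p_n` as a submodule; this is the
underlying space of the Conley (Morse) complex. -/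
def Msub (sp : ConsSplit C) : Submodule k V := ⨆ i : ℤ × P, LinearMap.range (sp.piM i.1 i.2)

/-- The differential `d̃ = i_B ∘ (⊕_p t^p|_{K^p}) ∘ j_K`. -/
noncomputable def dtildeK (sp : ConsSplit C) : V →ₗ[k] V :=
  ∑ᶠ i : ℤ × P, C.tcomp i.1 i.2 i.2 ∘ₗ sp.piK i.1 i.2

/-- `ht` is the map `h̃ = -i_K ∘ (⊕_p (t^p|_{K^p})^{-1}) ∘ j_B`: it vanishes on
the `M`- and `K`-summands, and on each `B^p_n` it is minus the inverse of the
isomorphism `t^p_{n+1} : K^p_{n+1} → B^p_n`. -/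
def IsHTilde (sp : ConsSplit C) (ht : V →ₗ[k] V) : Prop :=
  (∀ n p, ht ∘ₗ sp.piM n p = 0) ∧ (∀ n p, ht ∘ₗ sp.piK n p = 0) ∧
  ∀ n p, ∀ v ∈ LinearMap.range (sp.piB n p),
    ht v ∈ LinearMap.range (sp.piK (n + 1) p) ∧ C.tcomp (n + 1) p p (ht v) = -v

end ConsSplit

/-! ## Ordered bases, pivots and separating bases -/

/-- `i` is the pivot index of `v` with respect to the coordinate functions
`coord`: the largest index at which `v` has a nonzero coefficient. -/
def IsPivot {k V : Type*} [Field k] [AddCommGroup V] [Module k V] {m : ℕ}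
    (coord : Fin m → V →ₗ[k] k) (v : V) (i : Fin m) : Prop :=
  coord i v ≠ 0 ∧ ∀ j : Fin m, coord j v ≠ 0 → j ≤ i

/-- `A n` is a totally ordered (by the order of `Fin (m n)`) basis of the
`n`-th chain group, with coordinate functionals `coord n`. -/
def IsOrderedBasisData {k V : Type*} [Field k] [AddCommGroup V] [Module k V]
    (C : ZCC k V) (m : ℤ → ℕ) (A : ∀ n : ℤ, Fin (m n) → V)
    (coord : ∀ n : ℤ, Fin (m n) → V →ₗ[k] k) : Prop :=
  ∀ n : ℤ, (∀ i, A n i ∈ C.gr.piece n) ∧ LinearIndependent k (A n) ∧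
    Submodule.span k (Set.range (A n)) = C.gr.piece n ∧
    ∀ v ∈ C.gr.piece n, v = ∑ i : Fin (m n), coord n i v • A n i

/-- `(H, B, Pp)` is a family of separating bases: for each `n`, the triple
`(H n, B n, Pp n)` is a separating basis for the `n`-th chain group with
respect to the ordered basis `A n`. -/
def IsSepSystem {k V : Type*} [Field k] [AddCommGroup V] [Module k V]
    (C : ZCC k V) (m : ℤ → ℕ) (A : ∀ n : ℤ, Fin (m n) → V)
    (coord : ∀ n : ℤ, Fin (m n) → V →ₗ[k] k) (H B Pp : ℤ → Set V) : Prop :=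
  ∀ n : ℤ,
    (H n ⊆ C.gr.piece n) ∧ (B n ⊆ C.gr.piece n) ∧ (Pp n ⊆ C.gr.piece n) ∧
    (H n).Finite ∧ (B n).Finite ∧ (Pp n).Finite ∧
    LinearIndependent k (fun x : ↥(H n) => (x : V)) ∧
    LinearIndependent k (fun x : ↥(B n) => (x : V)) ∧
    LinearIndependent k (fun x : ↥(Pp n) => (x : V)) ∧
    Disjoint (Submodule.span k (H n)) (Submodule.span k (B n)) ∧
    Disjoint (Submodule.span k (H n) ⊔ Submodule.span k (B n))
      (Submodule.span k (Pp n)) ∧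
    (Submodule.span k (H n) ⊔ Submodule.span k (B n) ⊔ Submodule.span k (Pp n)
      = C.gr.piece n) ∧
    Submodule.span k (B n) = C.bdries n ∧
    (Submodule.span k (H n) ⊔ Submodule.span k (B n) = C.cycles n) ∧
    (∀ v ∈ Pp n, C.d v ∈ B (n - 1)) ∧
    (∀ v ∈ H n ∪ Pp n, ∀ b ∈ B n, ∀ i, IsPivot (coord n) b i → coord n i v = 0) ∧
    (∀ z ∈ H n, ∀ i, IsPivot (coord n) z i →
      ∀ v, ((v ∈ H n ∧ v ≠ z) ∨ v ∈ Pp n) → coord n i v = 0) ∧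
    (∀ z ∈ H n, ∀ i, IsPivot (coord n) z i → coord n i z = 1)

/-- The set of basis vectors which are pivots of elements of `H`. -/
def pivotVecs {k V : Type*} [Field k] [AddCommGroup V] [Module k V] {mm : ℕ}
    (coord : Fin mm → V →ₗ[k] k) (A : Fin mm → V) (H : Set V) : Set V :=
  {w : V | ∃ z ∈ H, ∃ i : Fin mm, IsPivot coord z i ∧ w = A i}
section Echelon

variable {k V : Type*} [Field k] [AddCommGroup V] [Module k V]

theorem IsPivot.unique {m : ℕ} {c : Fin m → V →ₗ[k] k} {v : V} {i j : Fin m}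
    (hi : IsPivot c v i) (hj : IsPivot c v j) : i = j :=
  le_antisymm (hj.2 i hi.1) (hi.2 j hj.1)

theorem exists_isPivot {m : ℕ} (c : Fin m → V →ₗ[k] k) {v : V} (hv : ∃ i, c i v ≠ 0) :
    ∃ i, IsPivot c v i := by
  classical
  obtain ⟨i, hi⟩ := hv
  have hne : (Finset.univ.filter fun j => c j v ≠ 0).Nonempty := ⟨i, by simpa using hi⟩
  refine ⟨_, (Finset.mem_filter.mp (Finset.max'_mem _ hne)).2, fun j hj => ?_⟩
  exact Finset.le_max' _ _ (by simpa using hj)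

/-- The vectors whose coefficients vanish at the pivots of all elements of `T`. -/
def pivotAnnihilator {m : ℕ} (c : Fin m → V →ₗ[k] k) (T : Set V) : Submodule k V where
  carrier := {v | ∀ z ∈ T, ∀ i, IsPivot c z i → c i v = 0}
  add_mem' ha hb z hz i hi := by rw [map_add, ha z hz i hi, hb z hz i hi, add_zero]
  zero_mem' _ _ _ _ := map_zero _
  smul_mem' a v hv z hz i hi := by rw [map_smul, hv z hz i hi, smul_zero]

/-- The members of a reduced echelon basis, indexed by their pivots. -/
theorem exists_dual_at_pivots {m : ℕ} (c : Fin m → V →ₗ[k] k) (U : Submodule k V) :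
    ∃ u : Fin m → V, ∀ i, (∃ v ∈ U, IsPivot c v i) → u i ∈ U ∧
      ∀ j, (∃ v ∈ U, IsPivot c v j) → c j (u i) = if j = i then 1 else 0 := by
  classical
  suffices h : ∀ i, ∃ w : V, (∃ v ∈ U, IsPivot c v i) → w ∈ U ∧
      ∀ j, (∃ v ∈ U, IsPivot c v j) → c j w = if j = i then 1 else 0 by
    choose u hu using h
    exact ⟨u, hu⟩
  intro i
  induction i using WellFoundedLT.induction with
  | ind i ih =>
    by_cases hi : ∃ v ∈ U, IsPivot c v i
    · choose! u hu using ih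
      obtain ⟨v, hvU, hv⟩ := hi
      set F := Finset.univ.filter fun j => j < i ∧ ∃ v ∈ U, IsPivot c v j with hF
      refine ⟨(c i v)⁻¹ • (v - ∑ j ∈ F, c j v • u j), fun _ => ⟨?_, fun j hj => ?_⟩⟩
      · refine U.smul_mem _ (U.sub_mem hvU (U.sum_mem fun j hj => U.smul_mem _ ?_))
        have := (Finset.mem_filter.mp hj).2
        exact (hu j this.1 this.2).1
      · have hsum : c j (∑ l ∈ F, c l v • u l) = if j ∈ F then c j v else 0 := by
          rw [map_sum, ← Finset.sum_ite_eq F j fun l => c l v]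
          refine Finset.sum_congr rfl fun l hl => ?_
          have := (Finset.mem_filter.mp hl).2
          rw [map_smul, (hu l this.1 this.2).2 j hj]
          simp
        have hjF : j ∈ F ↔ j < i := by simp only [hF, Finset.mem_filter, Finset.mem_univ,
          true_and, and_iff_left hj]
        rw [map_smul, map_sub, hsum, smul_eq_mul]
        rcases lt_trichotomy j i with h | h | h
        · simp [hjF.2 h, h.ne]
        · subst h
          simp [hjF, hv.1]
        · have h0 : c j v = 0 := by
            by_contra h0
            exact absurd (hv.2 j h0) (not_le.mpr h)
          simp [hjF, not_lt.mpr h.le, h.ne', h0]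
    · exact ⟨0, fun h => absurd h hi⟩

/-- Every subspace on which the coordinates separate points has a reduced echelon basis. -/
theorem exists_reduced_echelon_basis {m : ℕ} (c : Fin m → V →ₗ[k] k) (U : Submodule k V)
    (hU : ∀ v ∈ U, (∀ i, c i v = 0) → v = 0) :
    ∃ T : Set V, T.Finite ∧ LinearIndepOn k id T ∧ span k T = U ∧
      (∀ z ∈ T, ∀ i, IsPivot c z i → c i z = 1 ∧ ∀ w ∈ T, w ≠ z → c i w = 0) ∧
      IsCompl U (pivotAnnihilator c T) := by
  classical
  obtain ⟨u, hu⟩ := exists_dual_at_pivots c U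
  set S : Finset (Fin m) := Finset.univ.filter fun i => ∃ v ∈ U, IsPivot c v i with hS
  have hmem : ∀ i, i ∈ S ↔ ∃ v ∈ U, IsPivot c v i := by simp [hS]
  simp only [← hmem] at hu
  have hzero : ∀ v ∈ U, (∀ i ∈ S, c i v = 0) → v = 0 := by
    intro v hv h
    by_contra hne
    obtain ⟨i, hi⟩ := exists_isPivot c (v := v) (by
      by_contra! h0
      exact hne (hU v hv h0))
    exact hi.1 (h i ((hmem i).2 ⟨v, hv, hi⟩))
  have hpiv : ∀ i ∈ S, IsPivot c (u i) i := by
    intro i hi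
    have h1 : c i (u i) = 1 := by simp [(hu i hi).2 i hi]
    obtain ⟨j, hj⟩ := exists_isPivot c (v := u i) ⟨i, by simp [h1]⟩
    have hji : j = i := by
      by_contra h
      exact hj.1 (by rw [(hu i hi).2 j ((hmem j).2 ⟨_, (hu i hi).1, hj⟩), if_neg h])
    exact hji ▸ hj
  have hcoord : ∀ a : Fin m → k, ∀ j ∈ S, c j (∑ i ∈ S, a i • u i) = a j := by
    intro a j hj
    rw [map_sum, Finset.sum_congr rfl fun i hi => by
      rw [map_smul, (hu i hi).2 j hj, smul_eq_mul, mul_ite, mul_one, mul_zero]]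
    simp [hj]
  have hmemU : ∀ a : Fin m → k, ∑ i ∈ S, a i • u i ∈ U := fun a =>
    U.sum_mem fun i hi => U.smul_mem _ (hu i hi).1
  have hann : ∀ v, v ∈ pivotAnnihilator c (u '' S) ↔ ∀ i ∈ S, c i v = 0 := by
    intro v
    constructor
    · exact fun h i hi => h _ ⟨i, hi, rfl⟩ i (hpiv i hi)
    · rintro h _ ⟨i, hi, rfl⟩ j hj
      rw [hj.unique (hpiv i hi)]
      exact h i hi
  refine ⟨u '' S, S.finite_toSet.image u, LinearIndepOn.id_image ?_, ?_, ?_, ?_⟩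
  · rw [linearIndepOn_finset_iff]
    intro a ha i hi
    rw [← hcoord a i hi, ha, map_zero]
  · refine le_antisymm (span_le.mpr ?_) fun v hv => ?_
    · rintro _ ⟨i, hi, rfl⟩
      exact (hu i hi).1
    · have : v - ∑ i ∈ S, c i v • u i = 0 := by
        refine hzero _ (U.sub_mem hv (hmemU fun i => c i v)) fun j hj => ?_
        rw [map_sub, hcoord (fun i => c i v) j hj, sub_self]
      rw [sub_eq_zero.mp this]
      exact sum_mem fun i hi => smul_mem _ _ (subset_span ⟨i, hi, rfl⟩)
  · rintro _ ⟨i, hi, rfl⟩ j hj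
    obtain rfl := hj.unique (hpiv i hi)
    refine ⟨by simp [(hu j hi).2 j hi], ?_⟩
    rintro _ ⟨l, hl, rfl⟩ hne
    rw [(hu l hl).2 j hi, if_neg]
    rintro rfl
    exact hne rfl
  · constructor
    · rw [disjoint_def]
      exact fun v hv h => hzero v hv ((hann v).1 h)
    · rw [codisjoint_iff_exists_add_eq]
      intro v
      refine ⟨_, v - ∑ i ∈ S, c i v • u i, hmemU fun i => c i v, ?_, add_sub_cancel _ _⟩
      rw [hann]
      intro j hj
      rw [map_sub, hcoord (fun i => c i v) j hj, sub_self]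

end Echelon

/-- A linear map has a linear section over the image of any subspace, with values in it. -/
theorem exists_linear_section_on_map {k V V' : Type*} [Field k] [AddCommGroup V] [Module k V]
    [AddCommGroup V'] [Module k V'] (f : V →ₗ[k] V') (W : Submodule k V) :
    ∃ p : V' →ₗ[k] V, ∀ x ∈ W.map f, p x ∈ W ∧ f (p x) = x := by
  obtain ⟨g, hg⟩ := (f.submoduleMap W).exists_rightInverse_of_surjective
    (LinearMap.range_eq_top.mpr (f.submoduleMap_surjective W))
  obtain ⟨p, hp⟩ := LinearMap.exists_extend (W.subtype ∘ₗ g)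
  refine ⟨p, fun x hx => ?_⟩
  have hpx : p x = g ⟨x, hx⟩ := LinearMap.congr_fun hp ⟨x, hx⟩
  rw [hpx]
  exact ⟨(g _).2, congrArg Subtype.val (LinearMap.congr_fun hg ⟨x, hx⟩)⟩

theorem ZCC.bdries_le_cycles {k V : Type*} [Field k] [AddCommGroup V] [Module k V]
    (C : ZCC k V) (n : ℤ) : C.bdries n ≤ C.cycles n := by
  rintro _ ⟨v, hv, rfl⟩
  refine ⟨?_, LinearMap.congr_fun C.d_sq v⟩
  simpa using C.d_deg (n + 1) v hv

/-- Let `(C, d)` be a bounded chain complex of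
finite-dimensional `k`-vector spaces with a fixed totally ordered finite
basis of each chain group.  Then for each `n` there exists a separating basis
`(ℌ_n, 𝔅_n, 𝔓_n)` for `C_n` with respect to the given basis. -/
theorem stmt6 {k V : Type*} [Field k] [AddCommGroup V] [Module k V]
    (C : ZCC k V) (hbd : C.Bounded) [FiniteDimensional k V]
    (m : ℤ → ℕ) (A : ∀ n : ℤ, Fin (m n) → V)
    (coord : ∀ n : ℤ, Fin (m n) → V →ₗ[k] k)
    (hbasis : IsOrderedBasisData C m A coord) :
    ∃ H B Pp : ℤ → Set V, IsSepSystem C m A coord H B Pp := by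
  have hsep : ∀ n, ∀ v ∈ C.gr.piece n, (∀ i, coord n i v = 0) → v = 0 := by
    intro n v hv h
    rw [(hbasis n).2.2.2 v hv]
    simp [h]
  have hcyc : ∀ n, C.cycles n ≤ C.gr.piece n := fun n => inf_le_left
  choose B hBfin hBind hBspan hBred hBcompl using fun n =>
    exists_reduced_echelon_basis (coord n) (C.bdries n) fun v hv =>
      hsep n v (hcyc n (C.bdries_le_cycles n hv))
  choose H hHfin hHind hHspan hHred hHcompl using fun n =>
    exists_reduced_echelon_basis (coord n) (C.cycles n ⊓ pivotAnnihilator (coord n) (B n))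
      fun v hv => hsep n v (hcyc n hv.1)
  choose p hp using fun n => exists_linear_section_on_map C.d
    (C.gr.piece n ⊓ pivotAnnihilator (coord n) (B n) ⊓ pivotAnnihilator (coord n) (H n))
  have hsup : ∀ n, span k (H n) ⊔ span k (B n) = C.cycles n := by
    intro n
    rw [hHspan, hBspan, sup_comm, inf_comm, ← sup_inf_assoc_of_le _ (C.bdries_le_cycles n),
      (hBcompl n).sup_eq_top, top_inf_eq]
  have hmap : ∀ n, (C.gr.piece n ⊓ pivotAnnihilator (coord n) (B n) ⊓
      pivotAnnihilator (coord n) (H n)).map C.d = C.bdries (n - 1) := by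
    intro n
    rw [ZCC.bdries, sub_add_cancel]
    refine le_antisymm (map_mono (inf_le_left.trans inf_le_left)) ?_
    rintro _ ⟨v, hv, rfl⟩
    obtain ⟨b, w, hb, hw, rfl⟩ := codisjoint_iff_exists_add_eq.mp (hBcompl n).codisjoint v
    obtain ⟨h, x, hh, hx, rfl⟩ := codisjoint_iff_exists_add_eq.mp (hHcompl n).codisjoint w
    have hb' := C.bdries_le_cycles n hb
    refine ⟨x, ⟨⟨?_, ?_⟩, hx⟩, ?_⟩
    · have := sub_mem (sub_mem hv hb'.1) hh.1.1
      simpa using this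
    · have := sub_mem hw hh.2
      simpa using this
    · rw [map_add, map_add, LinearMap.mem_ker.mp hb'.2, LinearMap.mem_ker.mp hh.1.2, zero_add,
        zero_add]
  simp only [hmap] at hp
  have hBmem : ∀ n, ∀ b ∈ B n, b ∈ C.bdries n := fun n b hb => hBspan n ▸ subset_span hb
  have hHmem : ∀ n, ∀ z ∈ H n, z ∈ C.cycles n ⊓ pivotAnnihilator (coord n) (B n) :=
    fun n z hz => hHspan n ▸ subset_span hz
  have hPspan : ∀ n, span k (p n '' B (n - 1)) = (C.bdries (n - 1)).map (p n) := by
    intro n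
    rw [span_image, hBspan]
  refine ⟨H, B, fun n => p n '' B (n - 1), fun n => ⟨fun z hz => (hHmem n z hz).1.1,
    fun b hb => (C.bdries_le_cycles n (hBmem n b hb)).1, ?_, hHfin n, hBfin n,
    (hBfin _).image _, hHind n, hBind n, LinearIndepOn.id_image ?_, ?_, ?_, ?_, hBspan n,
    hsup n, ?_, ?_, ?_, fun z hz i hi => (hHred n z hz i hi).1⟩⟩
  · rintro _ ⟨b, hb, rfl⟩
    exact (hp n b (hBmem _ b hb)).1.1.1
  · refine LinearIndependent.of_comp C.d (LinearIndepOn.congr (hBind (n - 1)) fun b hb =>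
      (hp n b (hBmem _ b hb)).2.symm : LinearIndepOn k (C.d ∘ p n) (B (n - 1)))
  · rw [hHspan, hBspan]
    exact ((hBcompl n).disjoint.mono_right inf_le_right).symm
  · rw [hsup, hPspan, disjoint_def]
    rintro _ hx ⟨y, hy, rfl⟩
    have : y = 0 := by rw [← (hp n y hy).2]; exact hx.2
    rw [this, map_zero]
  · rw [hsup, hPspan]
    refine le_antisymm (sup_le (hcyc n) ?_) fun v hv => ?_
    · rintro _ ⟨y, hy, rfl⟩
      exact (hp n y hy).1.1.1
    · have hdv : C.d v ∈ C.bdries (n - 1) := ⟨v, by rwa [sub_add_cancel], rfl⟩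
      refine mem_sup.mpr ⟨v - p n (C.d v), ⟨sub_mem hv (hp n _ hdv).1.1.1, ?_⟩, _,
        mem_map_of_mem hdv, sub_add_cancel _ _⟩
      exact LinearMap.mem_ker.mpr (by rw [map_sub, (hp n _ hdv).2, sub_self])
  · rintro _ ⟨b, hb, rfl⟩
    rwa [(hp n b (hBmem _ b hb)).2]
  · rintro v (hv | ⟨b, hb, rfl⟩)
    · exact (hHmem n v hv).2
    · exact (hp n b (hBmem _ b hb)).1.1.2
  · rintro z hz i hi v (⟨hv, hne⟩ | ⟨b, hb, rfl⟩)
    · exact (hHred n z hz i hi).2 v hv hne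
    · exact (hp n b (hBmem _ b hb)).1.2 z hz i hi
end

section
/- Let k be a field, P a finite poset, and (C,d) a bounded P-graded chain complex of finite-dimensional k-vector spaces with a consistent splitting, and let h̃, δ, S be the associated maps. Fix p ∈ P, let z be an element of the M-summand M^p_n ⊆ C^p_n, and let y ∈ C_n be an element whose component y^q lies in the K-summand K^q_n for every q < p and whose components vanish at all other grades. If for every s ∈ P the component (d(z+y))^s ∈ C^s_{n-1} lies in M^s_{n-1} ⊕ K^s_{n-1} (i.e., has zero component in B^s_{n-1}), then y = h̃S(z). -/
open LinearMap Submodule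

namespace VGrading

variable {k V ι : Type*} [Field k] [AddCommGroup V] [Module k V]

theorem proj_proj_self (G : VGrading k V ι) (i : ι) (v : V) :
    G.proj i (G.proj i v) = G.proj i v :=
  LinearMap.congr_fun (G.proj_idem i) v

/-- If `f` kills every homogeneous component of `v`, then `f` kills `v`. -/
theorem map_eq_zero_of_proj {W : Type*} [AddCommGroup W] [Module k W] (G : VGrading k V ι)
    (f : V →ₗ[k] W) (v : V) (h : ∀ i, f (G.proj i v) = 0) : f v = 0 := by
  rw [← G.proj_total v, ← LinearMap.toAddMonoidHom_coe,
    AddMonoidHom.map_finsum _ (G.proj_finite v)]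
  exact finsum_eq_zero_of_forall_eq_zero h

theorem proj_eq_zero_of_mem_range (G : VGrading k V ι) {i j : ι} (hij : i ≠ j) {v : V}
    (hv : v ∈ LinearMap.range (G.proj j)) : G.proj i v = 0 := by
  obtain ⟨w, rfl⟩ := hv
  exact LinearMap.congr_fun (G.proj_orth i j hij) w

end VGrading

namespace PCC

variable {k V P : Type*} [Field k] [AddCommGroup V] [Module k V] [PartialOrder P]

theorem tcomp_proj (C : PCC k V P) (m : ℤ) (r q : P) (v : V) :
    C.tcomp m r q (C.gr.proj (m, q) v) = C.tcomp m r q v := by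
  simp [tcomp, C.gr.proj_proj_self]

theorem dtilde_apply (C : PCC k V P) (hbd : C.Bounded) (v : V) :
    C.dtilde v = ∑ i ∈ hbd.toFinset, C.tcomp i.1 i.2 i.2 v := by
  rw [dtilde, finsum_eq_sum_of_support_subset (s := hbd.toFinset), LinearMap.sum_apply]
  · rfl
  · intro i hi
    refine Finset.mem_coe.2 ((Set.Finite.mem_toFinset hbd).2 fun h0 => hi ?_)
    simp [h0]

theorem sum_proj (C : PCC k V P) (hbd : C.Bounded) (v : V) :
    ∑ i ∈ hbd.toFinset, C.gr.proj i v = v := by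
  conv_rhs => rw [← C.gr.proj_total v]
  refine (finsum_eq_sum_of_support_subset _ ?_).symm
  intro i hi
  refine Finset.mem_coe.2 ((Set.Finite.mem_toFinset hbd).2 fun h0 => hi ?_)
  simp [h0]

/-- The differential of an element concentrated in degree `n` is concentrated in
degree `n - 1`. -/
theorem proj_d_eq_zero (C : PCC k V P) {n m : ℤ} (hm : m ≠ n - 1) (s : P) {v : V}
    (hv : ∀ (l : ℤ) (q : P), l ≠ n → C.gr.proj (l, q) v = 0) :
    C.gr.proj (m, s) (C.d v) = 0 := by
  refine C.gr.map_eq_zero_of_proj (C.gr.proj (m, s) ∘ₗ C.d) v ?_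
  rintro ⟨l, q⟩
  by_cases hl : l = n
  · subst hl
    rcases C.d_filt l m s q with h | h
    · exact absurd h.1 hm
    · exact LinearMap.congr_fun h v
  · rw [hv l q hl, map_zero]

end PCC

namespace ConsSplit

variable {k V P : Type*} [Field k] [AddCommGroup V] [Module k V] [PartialOrder P]
  {C : PCC k V P}

theorem range_piM_le (sp : ConsSplit C) (n : ℤ) (p : P) :
    LinearMap.range (sp.piM n p)
      ≤ LinearMap.range (C.gr.proj (n, p)) ⊓ LinearMap.ker (C.tcomp n p p) :=
  sp.ker_split n p ▸ le_sup_left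

theorem dtilde_eq_zero_of_mem_range_piM (sp : ConsSplit C) (hbd : C.Bounded) {n : ℤ} {p : P}
    {z : V} (hz : z ∈ LinearMap.range (sp.piM n p)) : C.dtilde z = 0 := by
  obtain ⟨hzr, hzk⟩ := sp.range_piM_le n p hz
  rw [C.dtilde_apply hbd]
  refine Finset.sum_eq_zero ?_
  rintro ⟨m, q⟩ -
  by_cases hi : (m, q) = (n, p)
  · obtain ⟨rfl, rfl⟩ := Prod.mk.inj hi
    exact hzk
  · rw [← C.tcomp_proj, C.gr.proj_eq_zero_of_mem_range hi hzr, map_zero]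

theorem IsHTilde.apply_tcomp {sp : ConsSplit C} {ht : V →ₗ[k] V} (hht : sp.IsHTilde ht)
    {n : ℤ} {q : P} {v : V} (hv : v ∈ LinearMap.range (sp.piK n q)) :
    ht (C.tcomp n q q v) = -v := by
  have hb : C.tcomp n q q v ∈ LinearMap.range (sp.piB (n - 1) q) :=
    sp.K_onto n q ▸ Submodule.mem_map_of_mem hv
  obtain ⟨hK, hneg⟩ := hht.2.2 _ _ _ hb
  rw [sub_add_cancel] at hK hneg
  rw [eq_neg_iff_add_eq_zero]
  refine sp.K_inj n q _ (add_mem hK hv) ?_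
  rw [map_add, hneg, neg_add_cancel]

theorem IsHTilde.apply_dtilde {sp : ConsSplit C} {ht : V →ₗ[k] V} (hht : sp.IsHTilde ht)
    (hbd : C.Bounded) {y : V}
    (hy : ∀ (m : ℤ) (q : P), C.gr.proj (m, q) y ∈ LinearMap.range (sp.piK m q)) :
    ht (C.dtilde y) = -y := by
  conv_rhs => rw [← C.sum_proj hbd y]
  rw [C.dtilde_apply hbd, map_sum, ← Finset.sum_neg_distrib]
  refine Finset.sum_congr rfl ?_
  rintro ⟨m, q⟩ -
  rw [← C.tcomp_proj, hht.apply_tcomp (hy m q)]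

theorem IsHTilde.apply_eq_zero {sp : ConsSplit C} {ht : V →ₗ[k] V} (hht : sp.IsHTilde ht)
    {w : V} (hw : ∀ (m : ℤ) (s : P), sp.piB m s w = 0) : ht w = 0 := by
  refine C.gr.map_eq_zero_of_proj ht w ?_
  rintro ⟨m, s⟩
  have hM : ht (sp.piM m s w) = 0 := LinearMap.congr_fun (hht.1 m s) w
  have hK : ht (sp.piK m s w) = 0 := LinearMap.congr_fun (hht.2.1 m s) w
  simp [← sp.sum_eq m s, hM, hK, hw m s]

theorem piB_eq_zero_of_proj (sp : ConsSplit C) {m : ℤ} {s : P} {w : V}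
    (hw : C.gr.proj (m, s) w = 0) : sp.piB m s w = 0 := by
  have hM : sp.piB m s (sp.piM m s w) = 0 := LinearMap.congr_fun (sp.orth_BM m s) w
  have hK : sp.piB m s (sp.piK m s w) = 0 := LinearMap.congr_fun (sp.orth_BK m s) w
  have hB : sp.piB m s (sp.piB m s w) = sp.piB m s w := LinearMap.congr_fun (sp.idem_B m s) w
  have h := congrArg (sp.piB m s) hw
  simpa [← sp.sum_eq m s, hM, hK, hB] using h

end ConsSplit

/-- Iterating a fixed-point equation `y = f z + f y`. -/
theorem eq_sum_endPow_add {k V : Type*} [Field k] [AddCommGroup V] [Module k V]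
    {f : V →ₗ[k] V} {z y : V} (h : y = f z + f y) (m : ℕ) :
    y = ∑ i ∈ Finset.range m, f (endPow f i z) + endPow f m y := by
  induction m with
  | zero => simp [endPow]
  | succ m ih =>
    have hcomm : ∀ (j : ℕ) (v : V), endPow f j (f v) = f (endPow f j v) := by
      intro j v
      induction j with
      | zero => rfl
      | succ j ihj => simp [endPow, ihj]
    have h' : endPow f m y = f (endPow f m z) + f (endPow f m y) := by
      rw [← hcomm, ← hcomm, ← map_add, ← h]
    rw [Finset.sum_range_succ, add_assoc]
    change y = _ + (f (endPow f m z) + f (endPow f m y))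
    rw [← h']
    exact ih

/-- The perturbation series solves the fixed-point equation `y = hδz + hδy`. -/
theorem IsPerturbSum.eq_of_fixed {k V : Type*} [Field k] [AddCommGroup V] [Module k V]
    {δ h S : V →ₗ[k] V} (hS : IsPerturbSum δ h S) {z y : V}
    (hy : y = h (δ z) + h (δ y)) : y = h (S z) := by
  obtain ⟨N, hN, hSz⟩ := hS z
  obtain ⟨N', hN', -⟩ := hS y
  have key := eq_sum_endPow_add (f := h ∘ₗ δ) hy (max N N')
  rw [hN' _ (le_max_right _ _), add_zero] at key
  rw [key, hSz, map_sum]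
  symm
  refine Finset.sum_subset (Finset.range_mono (le_max_left _ _)) ?_
  intro i _ hi
  simp [hN i (by simpa using hi)]

/-- Let `(C, d)` be a bounded `P`-graded chain complex of
finite-dimensional vector spaces with a consistent splitting, and `h̃`, `δ`,
`S` the associated maps.  Fix `p`, let `z ∈ M^p_n` and let `y ∈ C_n` be an
element whose component at each grade `q < p` lies in `K^q_n` and whose
components vanish at all other grades.  If for every `s` the component of
`d(z + y)` at grade `s` has zero component in `B^s_{n-1}`, then `y = h̃S(z)`. -/
theorem stmt9 {k V P : Type*} [Field k] [AddCommGroup V] [Module k V]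
    [PartialOrder P] [Fintype P]
    (C : PCC k V P) (hbd : C.Bounded) [FiniteDimensional k V]
    (sp : ConsSplit C)
    (ht : V →ₗ[k] V) (hht : sp.IsHTilde ht)
    (S : V →ₗ[k] V) (hS : IsPerturbSum C.delta ht S)
    (p : P) (n : ℤ) (z y : V)
    (hz : z ∈ LinearMap.range (sp.piM n p))
    (hy1 : ∀ q : P, q < p → C.gr.proj (n, q) y ∈ LinearMap.range (sp.piK n q))
    (hy2 : ∀ (m : ℤ) (q : P), ¬ (m = n ∧ q < p) → C.gr.proj (m, q) y = 0)
    (hB : ∀ s : P, sp.piB (n - 1) s (C.d (z + y)) = 0) :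
    y = ht (S z) := by
  have hyK : ∀ (m : ℤ) (q : P), C.gr.proj (m, q) y ∈ LinearMap.range (sp.piK m q) := by
    intro m q
    by_cases h : m = n ∧ q < p
    · obtain ⟨rfl, hq⟩ := h
      exact hy1 q hq
    · rw [hy2 m q h]
      exact zero_mem _
  have hdeg : ∀ (l : ℤ) (q : P), l ≠ n → C.gr.proj (l, q) (z + y) = 0 := by
    intro l q hl
    rw [map_add, hy2 l q (fun h => hl h.1), add_zero]
    exact C.gr.proj_eq_zero_of_mem_range (fun h => hl (Prod.mk.inj h).1)
      (sp.range_piM_le n p hz).1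
  have hd : ht (C.d (z + y)) = 0 := by
    refine hht.apply_eq_zero fun m s => ?_
    by_cases hm : m = n - 1
    · rw [hm]
      exact hB s
    · exact sp.piB_eq_zero_of_proj (C.proj_d_eq_zero hm s hdeg)
  refine hS.eq_of_fixed ?_
  have hsplit : C.delta (z + y) = C.d (z + y) - C.dtilde (z + y) := rfl
  rw [← map_add, ← map_add, hsplit, map_sub, hd, map_add,
    sp.dtilde_eq_zero_of_mem_range_piM hbd hz, zero_add, hht.apply_dtilde hbd hyK, zero_sub,
    neg_neg]
end

section
/- Let P be a finite poset and let (C,d^C) and (D,d^D) be P-graded chain complexes over a field. Suppose (f, g, h, k) is a P-filtered chain homotopy equivalence between them: f : C → D and g : D → C are P-filtered chain maps, and h : C_n → C_{n+1}, k : D_n → D_{n+1} are P-filtered degree +1 maps with g∘f = 1_C + d^C h + h d^C and f∘g = 1_D + d^D k + k d^D. Then for every p ∈ P, the diagonal components f^p, g^p, h^p, k^p form a chain homotopy equivalence between the relative chain complexes (C^p, t^{C,p}) and (D^p, t^{D,p}): f^p and g^p are chain maps, g^p∘f^p = 1_{C^p} + t^{C,p} h^p + h^p t^{C,p}, and f^p∘g^p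 = 1_{D^p} + t^{D,p} k^p + k^p t^{D,p}. -/
open LinearMap Submodule

/-- The diagonal component of a composite of `P`-filtered maps, the first of which is
homogeneous, is the composite of the diagonal components. -/
theorem PFilt.diag_comp {k U V W P : Type*} [Field k] [AddCommGroup U] [Module k U]
    [AddCommGroup V] [Module k V] [AddCommGroup W] [Module k W] [PartialOrder P]
    {GU : VGrading k U (ℤ × P)} {GV : VGrading k V (ℤ × P)} {GW : VGrading k W (ℤ × P)}
    {a : U →ₗ[k] V} {b : V →ₗ[k] W} (ha : PFilt GU GV a) (hb : PFilt GV GW b)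
    {r : ℤ} (hdeg : HasDegZP GU GV a r) {n m : ℤ} (hm : m = n + r) (l : ℤ) (p : P) :
    (GW.proj (l, p) ∘ₗ (b ∘ₗ GV.proj (m, p))) ∘ₗ (GV.proj (m, p) ∘ₗ (a ∘ₗ GU.proj (n, p)))
      = GW.proj (l, p) ∘ₗ ((b ∘ₗ a) ∘ₗ GU.proj (n, p)) := by
  ext u
  have hidem := fun v => LinearMap.congr_fun (GV.proj_idem (m, p)) v
  simp only [LinearMap.comp_apply] at hidem ⊢
  rw [hidem]
  set v := a (GU.proj (n, p) u)
  have hsum : ((GW.proj (l, p)) ∘ₗ b) (∑ᶠ i, GV.proj i v)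
      = ∑ᶠ i, ((GW.proj (l, p)) ∘ₗ b) (GV.proj i v) :=
    (((GW.proj (l, p)) ∘ₗ b).toAddMonoidHom).map_finsum (GV.proj_finite v)
  rw [GV.proj_total v] at hsum
  refine (finsum_eq_single _ (m, p) ?_).symm.trans hsum.symm
  rintro ⟨m', q⟩ hne
  by_cases hm' : m' = n + r
  · by_cases hqp : q ≤ p
    · have hpq : ¬ p ≤ q := fun hpq =>
        hne (by rw [hm', hm, le_antisymm hqp hpq])
      exact LinearMap.congr_fun (hb m' l p q hpq) v
    · have h0 : GV.proj (m', q) v = 0 := LinearMap.congr_fun (ha n m' q p hqp) u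
      rw [h0, map_zero]
  · have h0 : GV.proj (m', q) v = 0 := LinearMap.congr_fun (hdeg n m' p q hm') u
    rw [h0, map_zero]

namespace PCC

variable {k V P : Type*} [Field k] [AddCommGroup V] [Module k V] [PartialOrder P]

theorem pFilt_d (C : PCC k V P) : PFilt C.gr C.gr C.d := fun n m p q hpq =>
  (C.d_filt n m p q).resolve_left fun hc => hpq hc.2

theorem hasDegZP_d (C : PCC k V P) : HasDegZP C.gr C.gr C.d (-1) := fun n m p q hm =>
  (C.d_filt n m q p).resolve_left fun hc => hm (by rw [hc.1, sub_eq_add_neg])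

variable {W : Type*} [AddCommGroup W] [Module k W]

/-- The diagonal components of a `P`-filtered chain map are chain maps between the
relative chain complexes. -/
theorem tcomp_comp_diag {C : PCC k V P} {D : PCC k W P} {f : V →ₗ[k] W}
    (hf : f ∘ₗ C.d = D.d ∘ₗ f) (hfP : PFilt C.gr D.gr f) (hfdeg : HasDegZP C.gr D.gr f 0)
    (p : P) (n : ℤ) :
    D.tcomp n p p ∘ₗ (D.gr.proj (n, p) ∘ₗ (f ∘ₗ C.gr.proj (n, p)))
      = (D.gr.proj (n - 1, p) ∘ₗ (f ∘ₗ C.gr.proj (n - 1, p))) ∘ₗ C.tcomp n p p := by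
  unfold tcomp
  rw [hfP.diag_comp D.pFilt_d hfdeg (add_zero n).symm,
    C.pFilt_d.diag_comp hfP C.hasDegZP_d (sub_eq_add_neg n 1), hf]

/-- The diagonal components of a `P`-filtered chain homotopy between `g ∘ f` and the
identity form a chain homotopy on the relative chain complexes. -/
theorem diag_comp_eq_of_homotopy {C : PCC k V P} {D : PCC k W P} {f : V →ₗ[k] W}
    {g : W →ₗ[k] V} {h : V →ₗ[k] V}
    (hgf : g ∘ₗ f = LinearMap.id + C.d ∘ₗ h + h ∘ₗ C.d)
    (hfP : PFilt C.gr D.gr f) (hgP : PFilt D.gr C.gr g) (hhP : PFilt C.gr C.gr h)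
    (hfdeg : HasDegZP C.gr D.gr f 0) (hhdeg : HasDegZP C.gr C.gr h 1) (p : P) (n : ℤ) :
    (C.gr.proj (n, p) ∘ₗ (g ∘ₗ D.gr.proj (n, p)))
        ∘ₗ (D.gr.proj (n, p) ∘ₗ (f ∘ₗ C.gr.proj (n, p)))
      = C.gr.proj (n, p)
        + C.tcomp (n + 1) p p ∘ₗ (C.gr.proj (n + 1, p) ∘ₗ (h ∘ₗ C.gr.proj (n, p)))
        + (C.gr.proj (n, p) ∘ₗ (h ∘ₗ C.gr.proj (n - 1, p))) ∘ₗ C.tcomp n p p := by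
  unfold tcomp
  rw [add_sub_cancel_right, hfP.diag_comp hgP hfdeg (add_zero n).symm,
    hhP.diag_comp C.pFilt_d hhdeg rfl,
    C.pFilt_d.diag_comp hhP C.hasDegZP_d (sub_eq_add_neg n 1), hgf,
    LinearMap.add_comp, LinearMap.add_comp, LinearMap.comp_add, LinearMap.comp_add,
    LinearMap.id_comp, C.gr.proj_idem]

end PCC

/-- A `P`-filtered chain homotopy equivalence
`(f, g, h, k)` between `P`-graded chain complexes `(C, dC)` and `(D, dD)`
descends, for every `p ∈ P`, to a chain homotopy equivalence
`(f^p, g^p, h^p, k^p)` between the relative chain complexes `(C^p, t^{C,p})`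
and `(D^p, t^{D,p})`: `f^p, g^p` are chain maps,
`g^p f^p = 1 + t^{C,p} h^p + h^p t^{C,p}` and
`f^p g^p = 1 + t^{D,p} k^p + k^p t^{D,p}`. -/
theorem stmt15 {k V W P : Type*} [Field k] [AddCommGroup V] [Module k V]
    [AddCommGroup W] [Module k W] [PartialOrder P] [Fintype P]
    (C : PCC k V P) (D : PCC k W P)
    (f : V →ₗ[k] W) (g : W →ₗ[k] V) (h : V →ₗ[k] V) (kk : W →ₗ[k] W)
    (hfc : f ∘ₗ C.d = D.d ∘ₗ f) (hgc : g ∘ₗ D.d = C.d ∘ₗ g)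
    (hgf : g ∘ₗ f = LinearMap.id + C.d ∘ₗ h + h ∘ₗ C.d)
    (hfg : f ∘ₗ g = LinearMap.id + D.d ∘ₗ kk + kk ∘ₗ D.d)
    (hfP : PFilt C.gr D.gr f) (hgP : PFilt D.gr C.gr g)
    (hhP : PFilt C.gr C.gr h) (hkP : PFilt D.gr D.gr kk)
    (hfdeg : HasDegZP C.gr D.gr f 0) (hgdeg : HasDegZP D.gr C.gr g 0)
    (hhdeg : HasDegZP C.gr C.gr h 1) (hkdeg : HasDegZP D.gr D.gr kk 1) :
    ∀ (p : P) (n : ℤ),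
      -- `f^p` is a chain map:
      D.tcomp n p p ∘ₗ (D.gr.proj (n, p) ∘ₗ (f ∘ₗ C.gr.proj (n, p)))
        = (D.gr.proj (n - 1, p) ∘ₗ (f ∘ₗ C.gr.proj (n - 1, p))) ∘ₗ C.tcomp n p p ∧
      -- `g^p` is a chain map:
      C.tcomp n p p ∘ₗ (C.gr.proj (n, p) ∘ₗ (g ∘ₗ D.gr.proj (n, p)))
        = (C.gr.proj (n - 1, p) ∘ₗ (g ∘ₗ D.gr.proj (n - 1, p))) ∘ₗ D.tcomp n p p ∧
      -- `g^p ∘ f^p = 1_{C^p} + t^{C,p} h^p + h^p t^{C,p}`: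
      (C.gr.proj (n, p) ∘ₗ (g ∘ₗ D.gr.proj (n, p)))
          ∘ₗ (D.gr.proj (n, p) ∘ₗ (f ∘ₗ C.gr.proj (n, p)))
        = C.gr.proj (n, p)
          + C.tcomp (n + 1) p p ∘ₗ (C.gr.proj (n + 1, p) ∘ₗ (h ∘ₗ C.gr.proj (n, p)))
          + (C.gr.proj (n, p) ∘ₗ (h ∘ₗ C.gr.proj (n - 1, p))) ∘ₗ C.tcomp n p p ∧
      -- `f^p ∘ g^p = 1_{D^p} + t^{D,p} k^p + k^p t^{D,p}`:
      (D.gr.proj (n, p) ∘ₗ (f ∘ₗ C.gr.proj (n, p)))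
          ∘ₗ (C.gr.proj (n, p) ∘ₗ (g ∘ₗ D.gr.proj (n, p)))
        = D.gr.proj (n, p)
          + D.tcomp (n + 1) p p ∘ₗ (D.gr.proj (n + 1, p) ∘ₗ (kk ∘ₗ D.gr.proj (n, p)))
          + (D.gr.proj (n, p) ∘ₗ (kk ∘ₗ D.gr.proj (n - 1, p))) ∘ₗ D.tcomp n p p := by
  exact fun p n => ⟨PCC.tcomp_comp_diag hfc hfP hfdeg p n, PCC.tcomp_comp_diag hgc hgP hgdeg p n,
    PCC.diag_comp_eq_of_homotopy hgf hfP hgP hhP hfdeg hhdeg p n,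
    PCC.diag_comp_eq_of_homotopy hfg hgP hfP hkP hgdeg hkdeg p n⟩
end

section
/- Let P be a finite poset and (C,d) a P-graded chain complex over a field. If (M, d^M) is a Conley complex of (C,d), then for every p ∈ P and every n, the relative chain group M^p_n is isomorphic to the relative homology H_n(C^p, t^p). -/
open LinearMap Submodule

/-- A linear map between `(ℤ × P)`-graded spaces is `P`-filtered and of chain degree `r`. -/
def IsFiltDeg {k V W P : Type*} [Field k] [AddCommGroup V] [Module k V]
    [AddCommGroup W] [Module k W] [PartialOrder P]
    (GV : VGrading k V (ℤ × P)) (GW : VGrading k W (ℤ × P)) (a : V →ₗ[k] W) (r : ℤ) : Prop :=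
  ∀ i j : ℤ × P, ¬ (j.1 = i.1 + r ∧ j.2 ≤ i.2) → ∀ v, GW.proj j (a (GV.proj i v)) = 0

theorem PFilt.isFiltDeg {k V W P : Type*} [Field k] [AddCommGroup V] [Module k V]
    [AddCommGroup W] [Module k W] [PartialOrder P]
    {GV : VGrading k V (ℤ × P)} {GW : VGrading k W (ℤ × P)} {a : V →ₗ[k] W} {r : ℤ}
    (hP : PFilt GV GW a) (hdeg : HasDegZP GV GW a r) : IsFiltDeg GV GW a r := by
  rintro ⟨n, q⟩ ⟨m, p⟩ hij v
  by_cases hpq : p ≤ q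
  · exact LinearMap.congr_fun (hdeg n m q p fun h => hij ⟨h, hpq⟩) v
  · exact LinearMap.congr_fun (hP n m p q hpq) v

theorem PCC.isFiltDeg_d {k V P : Type*} [Field k] [AddCommGroup V] [Module k V]
    [PartialOrder P] (C : PCC k V P) : IsFiltDeg C.gr C.gr C.d (-1) := by
  rintro ⟨n, q⟩ ⟨m, p⟩ hij v
  rcases C.d_filt n m p q with h | h
  · exact absurd ⟨by simp only; omega, h.2⟩ hij
  · exact LinearMap.congr_fun h v

theorem VGrading.proj_proj {k V ι : Type*} [Field k] [AddCommGroup V] [Module k V]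
    (G : VGrading k V ι) (i : ι) (v : V) : G.proj i (G.proj i v) = G.proj i v :=
  LinearMap.congr_fun (G.proj_idem i) v

theorem VGrading.proj_eq_of_mem_range {k V ι : Type*} [Field k] [AddCommGroup V] [Module k V]
    (G : VGrading k V ι) {i : ι} {v : V} (hv : v ∈ LinearMap.range (G.proj i)) :
    G.proj i v = v := by
  obtain ⟨u, rfl⟩ := hv
  exact G.proj_proj i u

/-- A linear map that only sees the `i`-th component of `v` may be evaluated on that component. -/
theorem VGrading.map_proj_eq {k V W ι : Type*} [Field k] [AddCommGroup V] [Module k V]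
    [AddCommGroup W] [Module k W] (G : VGrading k V ι) (b : V →ₗ[k] W) (i : ι) (v : V)
    (hb : ∀ j, j ≠ i → b (G.proj j v) = 0) : b (G.proj i v) = b v := by
  conv_rhs => rw [← G.proj_total v]
  have hfin := b.toAddMonoidHom.map_finsum (G.proj_finite v)
  simp only [LinearMap.toAddMonoidHom_coe] at hfin
  rw [hfin, finsum_eq_single _ i hb]

/-- Diagonal components of filtered homogeneous maps compose. -/
theorem IsFiltDeg.proj_comp {k U V W P : Type*} [Field k] [AddCommGroup U] [Module k U]
    [AddCommGroup V] [Module k V] [AddCommGroup W] [Module k W] [PartialOrder P]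
    {GU : VGrading k U (ℤ × P)} {GV : VGrading k V (ℤ × P)} {GW : VGrading k W (ℤ × P)}
    {a : U →ₗ[k] V} {b : V →ₗ[k] W} {s r : ℤ}
    (hb : IsFiltDeg GV GW b r) (ha : IsFiltDeg GU GV a s) {n m : ℤ} (l : ℤ) {p : P}
    (hm : m = n + s) {u : U} (hu : GU.proj (n, p) u = u) :
    GW.proj (l, p) (b (GV.proj (m, p) (a u))) = GW.proj (l, p) (b (a u)) := by
  refine GV.map_proj_eq (GW.proj (l, p) ∘ₗ b) (m, p) (a u) ?_
  rintro ⟨j, q⟩ hj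
  by_cases hq : q ≤ p
  · by_cases hpq : p ≤ q
    · obtain rfl := le_antisymm hq hpq
      have hz := ha (n, q) (j, q) (fun h => hj (by rw [hm, ← h.1])) u
      rw [hu] at hz
      simp [hz]
    · exact hb (j, q) (l, p) (fun h => hpq h.2) (a u)
  · have hz := ha (n, p) (j, q) (fun h => hq h.2) u
    rw [hu] at hz
    simp [hz]

/-- Let `P` be a finite poset and `(C, d)` a `P`-graded
chain complex over a field.  If `(M, dM)` is a Conley complex of `(C, d)`
— i.e. there is a `P`-filtered chain homotopy equivalence between `(C, d)`
and `(M, dM)` and `dM` is strict — then for every `p` and `n` the relative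
chain group `M^p_n` is isomorphic to the relative homology `H_n(C^p, t^p)`. -/
theorem stmt16 {k V W P : Type*} [Field k] [AddCommGroup V] [Module k V]
    [AddCommGroup W] [Module k W] [PartialOrder P] [Fintype P]
    (C : PCC k V P) (M : PCC k W P)
    (f : V →ₗ[k] W) (g : W →ₗ[k] V) (h : V →ₗ[k] V) (kk : W →ₗ[k] W)
    (hfc : f ∘ₗ C.d = M.d ∘ₗ f) (hgc : g ∘ₗ M.d = C.d ∘ₗ g)
    (hgf : g ∘ₗ f = LinearMap.id + C.d ∘ₗ h + h ∘ₗ C.d)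
    (hfg : f ∘ₗ g = LinearMap.id + M.d ∘ₗ kk + kk ∘ₗ M.d)
    (hfP : PFilt C.gr M.gr f) (hgP : PFilt M.gr C.gr g)
    (hhP : PFilt C.gr C.gr h) (hkP : PFilt M.gr M.gr kk)
    (hfdeg : HasDegZP C.gr M.gr f 0) (hgdeg : HasDegZP M.gr C.gr g 0)
    (hhdeg : HasDegZP C.gr C.gr h 1) (hkdeg : HasDegZP M.gr M.gr kk 1)
    (hstrict : ∀ (n : ℤ) (p : P), M.tcomp n p p = 0) :
    ∀ (p : P) (n : ℤ),
      Nonempty (↥(LinearMap.range (M.gr.proj (n, p))) ≃ₗ[k] C.relHomology n p) := by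
  intro p n
  have Hf := hfP.isFiltDeg hfdeg
  have Hg := hgP.isFiltDeg hgdeg
  have Hh := hhP.isFiltDeg hhdeg
  have Hk := hkP.isFiltDeg hkdeg
  have HC := C.isFiltDeg_d
  have HM := M.isFiltDeg_d
  have Mstrict : ∀ (i : ℤ) (w : W), M.gr.proj (i, p) w = w → M.gr.proj (i - 1, p) (M.d w) = 0 := by
    intro i w hw
    have := LinearMap.congr_fun (hstrict i p) w
    simpa [PCC.tcomp, hw] using this
  have hrelC : ∀ x ∈ C.relCycles n p,
      C.gr.proj (n, p) x = x ∧ C.gr.proj (n - 1, p) (C.d x) = 0 := by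
    intro x hx
    have hx1 := C.gr.proj_eq_of_mem_range hx.1
    have hx2 : C.tcomp n p p x = 0 := hx.2
    exact ⟨hx1, by simpa [PCC.tcomp, hx1] using hx2⟩
  let φ : ↥(C.relCycles n p) →ₗ[k] ↥(LinearMap.range (M.gr.proj (n, p))) :=
    ((M.gr.proj (n, p)).rangeRestrict ∘ₗ f) ∘ₗ (C.relCycles n p).subtype
  have hφ : ∀ x, (φ x : W) = M.gr.proj (n, p) (f x) := fun x => rfl
  have hsurj : Function.Surjective φ := by
    rintro ⟨w, hw⟩
    replace hw := M.gr.proj_eq_of_mem_range hw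
    have hmem : C.gr.proj (n, p) (g w) ∈ C.relCycles n p := by
      refine ⟨⟨_, rfl⟩, ?_⟩
      change C.gr.proj (n - 1, p) (C.d (C.gr.proj (n, p) (C.gr.proj (n, p) (g w)))) = 0
      rw [C.gr.proj_proj, HC.proj_comp Hg (n - 1) (by omega) hw]
      have hc : C.d (g w) = g (M.d w) := (LinearMap.congr_fun hgc w).symm
      rw [hc, ← Hg.proj_comp HM (m := n - 1) (n - 1) (by omega) hw, Mstrict n w hw]
      simp
    refine ⟨⟨_, hmem⟩, Subtype.ext ?_⟩
    rw [hφ]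
    change M.gr.proj (n, p) (f (C.gr.proj (n, p) (g w))) = w
    rw [Hf.proj_comp Hg n (by omega) hw]
    have hc : f (g w) = w + M.d (kk w) + kk (M.d w) := LinearMap.congr_fun hfg w
    have hs := Mstrict (n + 1) _ (M.gr.proj_proj (n + 1, p) (kk w))
    rw [add_sub_cancel_right] at hs
    rw [hc, map_add, map_add, hw, ← HM.proj_comp Hk (m := n + 1) n rfl hw, hs,
      ← Hk.proj_comp HM (m := n - 1) n (by omega) hw, Mstrict n w hw]
    simp
  have hker : LinearMap.ker φ =
      Submodule.comap (C.relCycles n p).subtype (C.relBdries n p) := by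
    ext ⟨x, hx⟩
    obtain ⟨hx1, hx2⟩ := hrelC x hx
    rw [LinearMap.mem_ker, ← Subtype.coe_inj, hφ]
    change M.gr.proj (n, p) (f x) = 0 ↔ x ∈ LinearMap.range (C.tcomp (n + 1) p p)
    constructor
    · intro h0
      have e := Hg.proj_comp Hf (m := n) n (by omega) hx1
      have hc : g (f x) = x + C.d (h x) + h (C.d x) := LinearMap.congr_fun hgf x
      rw [h0, hc, map_add, map_add, hx1, ← HC.proj_comp Hh (m := n + 1) n rfl hx1,
        ← Hh.proj_comp HC (m := n - 1) n (by omega) hx1, hx2] at e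
      refine ⟨-h x, ?_⟩
      change C.gr.proj (n + 1 - 1, p) (C.d (C.gr.proj (n + 1, p) (-h x))) = x
      rw [add_sub_cancel_right]
      simp only [map_zero, add_zero, map_neg] at e ⊢
      exact (eq_neg_of_add_eq_zero_left e.symm).symm
    · rintro ⟨y, rfl⟩
      change M.gr.proj (n, p)
        (f (C.gr.proj (n + 1 - 1, p) (C.d (C.gr.proj (n + 1, p) y)))) = 0
      have hy := C.gr.proj_proj (n + 1, p) y
      generalize C.gr.proj (n + 1, p) y = z at hy ⊢
      have hc : f (C.d z) = M.d (f z) := LinearMap.congr_fun hfc z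
      have hs := Mstrict (n + 1) _ (M.gr.proj_proj (n + 1, p) (f z))
      rw [add_sub_cancel_right] at hs
      rw [Hf.proj_comp HC n (by omega) hy, hc,
        ← HM.proj_comp Hf (m := n + 1) n (by omega) hy, hs]
  exact ⟨((Submodule.quotEquivOfEq _ _ hker.symm).trans
    (φ.quotKerEquivOfSurjective hsurj)).symm⟩
end
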